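/- Let 0 ≤ λ < 2/√3 − 1, set ℓ = 1 + λ, and let φ₀ = arctan(1/√2). Let T³ = conv{t_1, t_2, t_3, t_4} be a regular 3-simplex of edge length 2 in E³ and set σ̄_3(λ) = vol_3(T³ ∩ ⋃_{i=1}^{4} (t_i + ℓB³)) / vol_3(T³). Then ((20√6·φ₀ − 4√6·π − 10π)·ℓ³ + 18π·ℓ² − 6π) / (3π − 15φ₀ + 5√2) < σ̄_3(λ). -/

import Mathlib

open MeasureTheory Metric


lemma frame_exists (t : Fin 4 → EuclideanSpace ℝ (Fin 3))
    (ht : ∀ i j : Fin 4, i ≠ j → ‖t i - t j‖ = 2) :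
    ∃ e : OrthonormalBasis (Fin 3) ℝ (EuclideanSpace ℝ (Fin 3)),
      e.repr (t 1 - t 0) = !₂[2, 0, 0] ∧ e.repr (t 2 - t 0) = !₂[1, √3, 0] ∧
      e.repr (t 3 - t 0) = !₂[1, 1/√3, 2*√2/√3] := by
  have s2 : √(2:ℝ) * √2 = 2 := Real.mul_self_sqrt (by norm_num)
  have s3 : √(3:ℝ) * √3 = 3 := Real.mul_self_sqrt (by norm_num)
  have n2 : √(2:ℝ) ≠ 0 := by positivity
  have n3 : √(3:ℝ) ≠ 0 := by positivity
  set u := t 1 - t 0 with hu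
  set v := t 2 - t 0 with hv
  set w := t 3 - t 0 with hw
  have uu : inner ℝ u u = 4 := by
    rw [real_inner_self_eq_norm_sq, ht 1 0 (by decide)]; norm_num
  have vv : inner ℝ v v = 4 := by
    rw [real_inner_self_eq_norm_sq, ht 2 0 (by decide)]; norm_num
  have ww : inner ℝ w w = 4 := by
    rw [real_inner_self_eq_norm_sq, ht 3 0 (by decide)]; norm_num
  have pol : ∀ a b : EuclideanSpace ℝ (Fin 3), inner ℝ a a = 4 → inner ℝ b b = 4 → ‖a - b‖ = 2 →
      inner ℝ a b = 2 := by
    intro a b ha hb hab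
    have := norm_sub_sq_real a b
    rw [hab, ← real_inner_self_eq_norm_sq a, ← real_inner_self_eq_norm_sq b, ha, hb] at this
    linarith
  have uv : inner ℝ u v = 2 := pol u v uu vv (by
    rw [hu, hv, sub_sub_sub_cancel_right]; exact ht 1 2 (by decide))
  have uw : inner ℝ u w = 2 := pol u w uu ww (by
    rw [hu, hw, sub_sub_sub_cancel_right]; exact ht 1 3 (by decide))
  have vw : inner ℝ v w = 2 := pol v w vv ww (by
    rw [hv, hw, sub_sub_sub_cancel_right]; exact ht 2 3 (by decide))
  have vu : inner ℝ v u = 2 := by rw [real_inner_comm]; exact uv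
  have wu : inner ℝ w u = 2 := by rw [real_inner_comm]; exact uw
  have wv : inner ℝ w v = 2 := by rw [real_inner_comm]; exact vw
  clear_value u v w
  let b : Fin 3 → EuclideanSpace ℝ (Fin 3) :=
    ![(1/2 : ℝ) • u, (1/√3) • (v - (1/2 : ℝ) • u), (√3/(2*√2)) • (w - (1/3 : ℝ) • u - (1/3 : ℝ) • v)]
  have ho : Orthonormal ℝ b := by
    rw [orthonormal_iff_ite]
    intro i j
    fin_cases i <;> fin_cases j <;>
      simp [-real_inner_self_eq_norm_sq, -inner_self_eq_norm_sq_to_K, b, inner_smul_left, inner_smul_right, inner_sub_left, inner_sub_right,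
        uu, vv, ww, uv, uw, vw, vu, wu, wv] <;> norm_num <;> field_simp <;> nlinarith
  let e := (OrthonormalBasis.mk ho (by
    rw [LinearIndependent.span_eq_top_of_card_eq_finrank ho.linearIndependent (by simp)]))
  have he : ⇑e = b := OrthonormalBasis.coe_mk _ _
  refine ⟨e, ?_, ?_, ?_⟩ <;>
  · ext i
    rw [OrthonormalBasis.repr_apply_apply, he]
    fin_cases i <;>
      simp [-real_inner_self_eq_norm_sq, -inner_self_eq_norm_sq_to_K, b, inner_smul_left, inner_sub_left,
        uu, vv, ww, uv, uw, vw, vu, wu, wv] <;> norm_num <;> field_simp <;> nlinarith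

lemma coords_exists (t : Fin 4 → EuclideanSpace ℝ (Fin 3))
    (ht : ∀ i j : Fin 4, i ≠ j → ‖t i - t j‖ = 2) :
    ∃ f : EuclideanSpace ℝ (Fin 3) → EuclideanSpace ℝ (Fin 3),
      MeasurePreserving f volume volume ∧
      Function.Injective f ∧
      (∀ p, ‖p - t 0‖^2 = (f p 0)^2 + (f p 1)^2 + (f p 2)^2) ∧
      (∀ p, ‖p - t 1‖^2 = (f p 0 - 2)^2 + (f p 1)^2 + (f p 2)^2) ∧
      (∀ p, ‖p - t 2‖^2 = (f p 0 - 1)^2 + (f p 1 - √3)^2 + (f p 2)^2) ∧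
      (∀ p, ‖p - t 3‖^2 = (f p 0 - 1)^2 + (f p 1 - 1/√3)^2 + (f p 2 - 2*√2/√3)^2) ∧
      (∀ w : Fin 4 → ℝ, ∑ i, w i = 1 → f (∑ i, w i • t i) =
        !₂[2 * w 1 + w 2 + w 3, √3 * w 2 + w 3 / √3, 2*√2/√3 * w 3]) := by
  obtain ⟨e, h1, h2, h3⟩ := frame_exists t ht
  refine ⟨fun p => e.repr (p - t 0), ?_, ?_, ?_, ?_, ?_, ?_, ?_⟩
  · exact e.measurePreserving_repr.comp (measurePreserving_sub_right volume (t 0))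
  · intro p q h
    simpa using h
  · intro p
    rw [← e.repr.norm_map, EuclideanSpace.norm_sq_eq]
    simp [Fin.sum_univ_three]
  · intro p
    have : p - t 1 = (p - t 0) - (t 1 - t 0) := by abel
    rw [this, ← e.repr.norm_map, map_sub, h1, EuclideanSpace.norm_sq_eq]
    simp [Fin.sum_univ_three]
  · intro p
    have : p - t 2 = (p - t 0) - (t 2 - t 0) := by abel
    rw [this, ← e.repr.norm_map, map_sub, h2, EuclideanSpace.norm_sq_eq]
    simp [Fin.sum_univ_three]
  · intro p
    have : p - t 3 = (p - t 0) - (t 3 - t 0) := by abel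
    rw [this, ← e.repr.norm_map, map_sub, h3, EuclideanSpace.norm_sq_eq]
    simp [Fin.sum_univ_three]
  · intro w hw
    have : ∑ i, w i • t i - t 0 = w 1 • (t 1 - t 0) + w 2 • (t 2 - t 0) + w 3 • (t 3 - t 0) := by
      rw [Fin.sum_univ_four] at hw ⊢
      have : w 0 = 1 - w 1 - w 2 - w 3 := by linarith
      rw [this]; module
    simp only [this, map_add, map_smul, h1, h2, h3]
    ext i
    fin_cases i <;> simp <;> ring

def openO (l : ℝ) : Set (EuclideanSpace ℝ (Fin 3)) :=
  {c | 0 < c 2 ∧ √2 * c 2 < c 1 ∧ √3 * c 1 < c 0 ∧ c 0 < 1 ∧ (c 0)^2 + (c 1)^2 + (c 2)^2 ≤ l^2}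

def closedO : Set (EuclideanSpace ℝ (Fin 3)) :=
  {c | 0 ≤ c 2 ∧ √2 * c 2 ≤ c 1 ∧ √3 * c 1 ≤ c 0 ∧ c 0 ≤ 1}

lemma meas_openO (l : ℝ) : MeasurableSet (openO l) := by
  unfold openO
  measurability

lemma hull_weights (t : Fin 4 → EuclideanSpace ℝ (Fin 3)) {p} (hp : p ∈ convexHull ℝ (Set.range t)) :
    ∃ w : Fin 4 → ℝ, (∀ i, 0 ≤ w i) ∧ ∑ i, w i = 1 ∧ ∑ i, w i • t i = p := by
  have : convexHull ℝ (Set.range t) ⊆ {p | ∃ w : Fin 4 → ℝ, (∀ i, 0 ≤ w i) ∧ ∑ i, w i = 1 ∧ ∑ i, w i • t i = p} := by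
    apply convexHull_min
    · rintro _ ⟨i, rfl⟩
      exact ⟨Pi.single i 1, fun j => by by_cases h : j = i <;> simp [Pi.single_apply, h], by simp,
        by simp [Pi.single_apply]⟩
    · rintro x ⟨w, h0, h1, rfl⟩ y ⟨w', h0', h1', rfl⟩ a b ha hb hab
      refine ⟨fun i => a * w i + b * w' i, fun i => ?_, ?_, ?_⟩
      · have := h0 i; have := h0' i; positivity
      · rw [Finset.sum_add_distrib, ← Finset.mul_sum, ← Finset.mul_sum, h1, h1']; linarith
      · simp only [add_smul, mul_smul, Finset.sum_add_distrib, Finset.smul_sum]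
  exact this hp

lemma geo_lower (l : ℝ) (hl : 0 ≤ l) (t : Fin 4 → EuclideanSpace ℝ (Fin 3))
    (ht : ∀ i j : Fin 4, i ≠ j → ‖t i - t j‖ = 2) :
    24 * volume (openO l) ≤ volume (convexHull ℝ (Set.range t) ∩ ⋃ i : Fin 4, closedBall (t i) l) := by
  have s2 : √(2:ℝ) * √2 = 2 := Real.mul_self_sqrt (by norm_num)
  have s3 : √(3:ℝ) * √3 = 3 := Real.mul_self_sqrt (by norm_num)
  have n2 : 0 < √(2:ℝ) := by positivity
  have n3 : 0 < √(3:ℝ) := by positivity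
  have H := fun σ : Equiv.Perm (Fin 4) => coords_exists (t ∘ σ)
    (fun i j hij => ht _ _ (σ.injective.ne hij))
  choose f hf hinj h0 h1 h2 h3 hw using H
  simp only [Function.comp] at h0 h1 h2 h3 hw
  have hmono : ∀ σ p, f σ p ∈ openO l → StrictMono ((fun i => ‖p - t i‖) ∘ σ) := by
    rintro σ p ⟨a1, a2, a3, a4, -⟩
    rw [Fin.strictMono_iff_lt_succ]
    intro i
    refine lt_of_pow_lt_pow_left₀ 2 (norm_nonneg _) ?_
    fin_cases i
    · simp only [Function.comp]
      have g0 := h0 σ p; have g1 := h1 σ p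
      simp at g0 g1 ⊢
      rw [g0, g1]; nlinarith
    · have g0 := h1 σ p; have g1 := h2 σ p
      simp at g0 g1 ⊢
      rw [g0, g1]; nlinarith
    · have g0 := h2 σ p; have g1 := h3 σ p
      have : ((3 : Fin 4)) = Fin.succ 2 := rfl
      simp at g0 g1 ⊢
      rw [g0, g1]
      have k1 : (√3)⁻¹ * √3 = 1 := inv_mul_cancel₀ n3.ne'
      have k2 : (√3)⁻¹ = √3 / 3 := by field_simp; linarith
      rw [div_eq_mul_inv, k2]
      nlinarith [mul_lt_mul_of_pos_left a2 n3]
  have hdisj : Pairwise (Function.onFun Disjoint fun σ => f σ ⁻¹' openO l) := by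
    intro σ τ hne
    rw [Function.onFun, Set.disjoint_left]
    intro p hp hq
    apply hne
    have a := hmono σ p hp
    have b := hmono τ p hq
    have c := Tuple.unique_monotone a.monotone b.monotone
    have d : Function.Injective (fun i => ‖p - t i‖) := by
      have := a.injective
      exact (Function.Injective.of_comp_iff' _ σ.bijective).1 this
    ext1 i
    exact d (congrFun c i)
  have hsub : (⋃ σ, f σ ⁻¹' openO l) ⊆ convexHull ℝ (Set.range t) ∩ ⋃ i : Fin 4, closedBall (t i) l := by
    intro p hp
    obtain ⟨σ, hp⟩ := Set.mem_iUnion.1 hp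
    obtain ⟨a1, a2, a3, a4, a5⟩ := hp
    refine ⟨?_, Set.mem_iUnion.2 ⟨σ 0, ?_⟩⟩
    · set x := f σ p 0 with hx
      set y := f σ p 1 with hy
      set z := f σ p 2 with hz
      let w3 := z * √3 / (2 * √2)
      let w2 := (y - z / (2 * √2)) / √3
      let w1 := (x - w2 - w3) / 2
      have k2 : (√3)⁻¹ = √3 / 3 := by field_simp; linarith
      have k3 : (√2)⁻¹ = √2 / 2 := by field_simp; linarith
      have e3 : w3 = z * (√3 * √2) / 4 := by
        simp only [w3]; rw [div_eq_mul_inv, mul_inv, k3]; ring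
      have e2 : w2 = y * √3 / 3 - z * (√3 * √2) / 12 := by
        simp only [w2]; rw [div_eq_mul_inv, div_eq_mul_inv, mul_inv, k2, k3]; ring
      have m := mul_lt_mul_of_pos_left a2 n3
      have m0 : 0 < √3 * (√2 * z) := by positivity
      have p3 : 0 ≤ w3 := by simp only [w3]; positivity
      have p2 : 0 ≤ w2 := by rw [e2]; nlinarith
      have e1 : w2 + w3 ≤ x / 2 := by rw [e2, e3]; nlinarith
      have hpos : ∀ i, 0 ≤ (![1 - w1 - w2 - w3, w1, w2, w3] : Fin 4 → ℝ) i := by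
        intro i
        fin_cases i
        · change 0 ≤ 1 - (x - w2 - w3) / 2 - w2 - w3
          linarith
        · change 0 ≤ (x - w2 - w3) / 2
          linarith
        · exact p2
        · exact p3
      have hsum : ∑ i, (![1 - w1 - w2 - w3, w1, w2, w3] : Fin 4 → ℝ) i = 1 := by
        simp [Fin.sum_univ_four]; ring
      refine mem_convexHull_of_exists_fintype _ (fun i => t (σ i)) hpos hsum (fun i => ⟨_, rfl⟩) ?_
      apply hinj σ
      rw [hw σ _ hsum]
      ext i
      fin_cases i
      · simp [w1, ← hx]; ring
      · simp [← hy, w2, w3]; field_simp; ring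
      · simp [← hz, w3]
    · rw [mem_closedBall, dist_eq_norm]
      refine le_of_sq_le_sq ?_ hl
      rw [h0 σ p]; exact a5
  calc 24 * volume (openO l) = ∑ σ, volume (f σ ⁻¹' openO l) := by
        simp only [(hf _).measure_preimage (meas_openO l).nullMeasurableSet]
        simp [Fintype.card_perm]; rfl
    _ = volume (⋃ σ, f σ ⁻¹' openO l) := by
        rw [measure_iUnion hdisj (fun σ => (hf σ).measurable (meas_openO l)), tsum_fintype]
    _ ≤ _ := measure_mono hsub

lemma meas_closedO : MeasurableSet closedO := by
  unfold closedO
  measurability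

lemma geo_upper (t : Fin 4 → EuclideanSpace ℝ (Fin 3))
    (ht : ∀ i j : Fin 4, i ≠ j → ‖t i - t j‖ = 2) :
    volume (convexHull ℝ (Set.range t)) ≤ 24 * volume closedO := by
  have s2 : √(2:ℝ) * √2 = 2 := Real.mul_self_sqrt (by norm_num)
  have s3 : √(3:ℝ) * √3 = 3 := Real.mul_self_sqrt (by norm_num)
  have n2 : 0 < √(2:ℝ) := by positivity
  have n3 : 0 < √(3:ℝ) := by positivity
  have H := fun σ : Equiv.Perm (Fin 4) => coords_exists (t ∘ σ)
    (fun i j hij => ht _ _ (σ.injective.ne hij))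
  choose f hf hinj h0 h1 h2 h3 hw using H
  simp only [Function.comp] at h0 h1 h2 h3 hw
  have hsub : convexHull ℝ (Set.range t) ⊆ (⋃ σ, f σ ⁻¹' closedO) := by
    intro p hp
    obtain ⟨w, w0, w1, rfl⟩ := hull_weights t hp
    let σ := Tuple.sort (fun i => - w i)
    have hm := Tuple.monotone_sort (fun i => - w i)
    have m1 : w (σ 1) ≤ w (σ 0) := neg_le_neg_iff.1 (hm (show (0 : Fin 4) ≤ 1 by decide))
    have m2 : w (σ 2) ≤ w (σ 1) := neg_le_neg_iff.1 (hm (show (1 : Fin 4) ≤ 2 by decide))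
    have m3 : w (σ 3) ≤ w (σ 2) := neg_le_neg_iff.1 (hm (show (2 : Fin 4) ≤ 3 by decide))
    refine Set.mem_iUnion.2 ⟨σ, ?_⟩
    have e1 : ∑ i, w (σ i) = 1 := by rw [Equiv.sum_comp σ w, w1]
    have e2 : ∑ i, w i • t i = ∑ i, w (σ i) • t (σ i) := (Equiv.sum_comp σ (fun i => w i • t i)).symm
    rw [Set.mem_preimage, e2, hw σ (fun i => w (σ i)) e1]
    rw [Fin.sum_univ_four] at e1
    have p3 := w0 (σ 3)
    have k2 : (√3)⁻¹ = √3 / 3 := by field_simp; linarith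
    refine ⟨?_, ?_, ?_, ?_⟩
    · simp; positivity
    · simp
      rw [div_eq_mul_inv, div_eq_mul_inv, k2]
      have e3 : √2 * (2 * √2 * (√3 / 3) * w (σ 3)) = √3 * w (σ 3) * (4 / 3) := by
        linear_combination (2 * (√3 / 3) * w (σ 3)) * s2
      have e4 := mul_le_mul_of_nonneg_left m3 n3.le
      rw [e3]; linarith
    · simp
      rw [div_eq_mul_inv, k2]
      nlinarith
    · simp
      linarith
  calc _ ≤ volume (⋃ σ, f σ ⁻¹' closedO) := measure_mono hsub
    _ ≤ ∑ σ, volume (f σ ⁻¹' closedO) := measure_iUnion_fintype_le _ _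
    _ = 24 * volume closedO := by
        simp only [(hf _).measure_preimage meas_closedO.nullMeasurableSet]
        simp [Fintype.card_perm]; rfl

lemma arctan_upper {x : ℝ} (hx : 0 ≤ x) : Real.arctan x ≤ x - x^3/3 + x^5/5 := by
  have hd : ∀ t : ℝ, HasDerivAt (fun t : ℝ => t - t^3/3 + t^5/5 - Real.arctan t)
      (1 - 3 * t^2/3 + 5 * t^4/5 - 1 / (1 + t^2)) t := by
    intro t
    have h := (((hasDerivAt_id t).sub ((hasDerivAt_pow 3 t).div_const 3)).add
      ((hasDerivAt_pow 5 t).div_const 5)).sub (Real.hasDerivAt_arctan t)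
    exact h.congr_deriv (by norm_num)
  have hm : Monotone (fun t : ℝ => t - t^3/3 + t^5/5 - Real.arctan t) := by
    refine monotone_of_hasDerivAt_nonneg hd fun t => ?_
    have : 1 - 3 * t^2/3 + 5 * t^4/5 - 1 / (1 + t^2) = t^6 / (1 + t^2) := by
      field_simp; ring
    rw [this]; simp only [Pi.zero_apply]; positivity
  have := hm hx
  norm_num at this
  linarith

lemma arctan_lower {x : ℝ} (hx : 0 ≤ x) : x - x^3/3 ≤ Real.arctan x := by
  have hd : ∀ t : ℝ, HasDerivAt (fun t : ℝ => Real.arctan t - (t - t^3/3))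
      (1 / (1 + t^2) - (1 - 3 * t^2/3)) t := by
    intro t
    have h := (Real.hasDerivAt_arctan t).sub ((hasDerivAt_id t).sub ((hasDerivAt_pow 3 t).div_const 3))
    exact h.congr_deriv (by norm_num)
  have hm : Monotone (fun t : ℝ => Real.arctan t - (t - t^3/3)) := by
    refine monotone_of_hasDerivAt_nonneg hd fun t => ?_
    have : 1 / (1 + t^2) - (1 - 3 * t^2/3) = t^4 / (1 + t^2) := by
      field_simp; ring
    rw [this]; simp only [Pi.zero_apply]; positivity
  have := hm hx
  norm_num at this
  linarith

lemma phi_bounds : 0.615 < Real.arctan (1 / Real.sqrt 2) ∧ Real.arctan (1 / Real.sqrt 2) < 0.628 := by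
  have h2 := Real.sq_sqrt (show (0:ℝ) ≤ 2 by norm_num)
  have h2a : 1.414 < √(2:ℝ) := Real.lt_sqrt_of_sq_lt (by norm_num)
  have h2b : √(2:ℝ) < 1.4143 := by rw [Real.sqrt_lt' (by norm_num)]; norm_num
  -- phi = pi/4 - arctan (3 - 2 √2)
  have key : Real.arctan (1 / √2) + Real.arctan (3 - 2 * √2) = Real.pi / 4 := by
    rw [Real.arctan_add, ← Real.arctan_one]
    · congr 1
      have : √(2:ℝ) ≠ 0 := by positivity
      have h4 : 1 - 1 / √2 * (3 - 2 * √2) ≠ 0 := by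
        have : 1 - 1 / √2 * (3 - 2 * √2) = (3 * √2 - 3) / √2 := by
          field_simp; ring
        rw [this]
        exact div_ne_zero (by linarith) (by positivity)
      rw [div_eq_one_iff_eq h4]
      field_simp
      nlinarith
    · rw [div_mul_eq_mul_div, div_lt_one (by positivity)]; nlinarith
  set x := 3 - 2 * √(2:ℝ) with hx
  have hx0 : 0 < x := by rw [hx]; linarith
  have hx1 : x < 0.172 := by rw [hx]; linarith
  have hx2 : 0.1714 ≤ x := by rw [hx]; linarith
  have up := arctan_upper hx0.le
  have lo := arctan_lower hx0.le
  have q1 := Real.pi_gt_d6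
  have q2 := Real.pi_lt_d6
  have hx3 : 0.029 ≤ x^2 := by nlinarith
  have hx4 : x^2 ≤ 0.0296 := by nlinarith
  have hx5 : x^3 = x * x^2 := by ring
  have hx6 : x^5 = x * (x^2 * x^2) := by ring
  have hx7 : x * 0.029 ≤ x^3 := by rw [hx5]; gcongr
  have hx8 : x^3 ≤ x * 0.0296 := by rw [hx5]; gcongr
  have hx9 : x^5 ≤ x * (0.0296 * 0.0296) := by rw [hx6]; gcongr
  constructor <;> linarith

lemma num (l : ℝ) (h1 : 1 ≤ l) (h2 : l < 2 / √3) :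
    ((20 * Real.sqrt 6 * Real.arctan (1 / Real.sqrt 2) - 4 * Real.sqrt 6 * Real.pi -
        10 * Real.pi) * l ^ 3 + 18 * Real.pi * l ^ 2 - 6 * Real.pi) /
      (3 * Real.pi - 15 * Real.arctan (1 / Real.sqrt 2) + 5 * Real.sqrt 2) <
    24 * (Real.arctan (1 / Real.sqrt 2) * (l^2/2 - 1/6) - Real.pi * l^3/18) / (2 * √2 / 3) := by
  obtain ⟨p1, p2⟩ := phi_bounds
  set φ := Real.arctan (1 / Real.sqrt 2)
  have q1 := Real.pi_gt_d6
  have q2 := Real.pi_lt_d6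
  have s2 := Real.sq_sqrt (show (0:ℝ) ≤ 2 by norm_num)
  have s3 := Real.sq_sqrt (show (0:ℝ) ≤ 3 by norm_num)
  have h2a : 1.414 < √(2:ℝ) := Real.lt_sqrt_of_sq_lt (by norm_num)
  have h2b : √(2:ℝ) < 1.4143 := by rw [Real.sqrt_lt' (by norm_num)]; norm_num
  have h3a : 1.732 < √(3:ℝ) := Real.lt_sqrt_of_sq_lt (by norm_num)
  have h6 : √(6:ℝ) = √2 * √3 := by rw [← Real.sqrt_mul (by norm_num)]; norm_num
  have hl : l < 1.1548 := by
    refine h2.trans ?_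
    rw [div_lt_iff₀ (by positivity)]; linarith
  set P := Real.pi
  rw [div_lt_div_iff₀ (by linarith) (by positivity), h6]
  have A : 12 * P - 16 * √3 < 9.988 := by linarith
  have B : 15.5 < 36 * (3 * φ - √2) := by linarith
  have C : 0 < P - 5 * φ := by linarith
  have Q : 0 < 36 * (3 * φ - √2) * (l^2 - 1/3) - (12 * P - 16 * √3) * l^3 := by
    have : 0 < 15.5 * (l^2-1/3) - 9.988 * l^3 := by
      nlinarith [mul_nonneg (sub_nonneg.2 h1) (sub_nonneg.2 hl.le), mul_nonneg (mul_nonneg (sub_nonneg.2 h1) (sub_nonneg.2 hl.le)) (by linarith : 0 ≤ l)]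
    have e1 : 15.5 * (l^2-1/3) ≤ 36 * (3 * φ - √2) * (l^2 - 1/3) := mul_le_mul_of_nonneg_right B.le (by nlinarith)
    have e2 : (12 * P - 16 * √3) * l^3 ≤ 9.988 * l^3 := mul_le_mul_of_nonneg_right A.le (by positivity)
    linarith
  have := mul_pos C Q
  have s23 : √2 * √2 = 2 := by nlinarith
  have s33 : √3 * √3 = 3 := by nlinarith
  have e : 24 * (φ * (l^2/2 - 1/6) - P * l^3/18) * (3 * P - 15 * φ + 5 * √2) - ((20 * (√2 * √3) * φ - 4 * (√2 * √3) * P - 10 * P) * l ^ 3 + 18 * P * l ^ 2 - 6 * P) * (2 * √2 / 3) = (1/3) * ((P - 5 * φ) * (36 * (3 * φ - √2) * (l^2 - 1/3) - (12 * P - 16 * √3) * l^3)) := by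
    linear_combination (- (20 * √3 * φ - 4 * √3 * P) * l^3 * 2/3) * s23
  linarith

lemma coord_mp : MeasurePreserving (fun c : EuclideanSpace ℝ (Fin 3) => (c 0, c 1, c 2))
    volume (volume : Measure (ℝ × ℝ × ℝ)) := by
  have h1 := EuclideanSpace.volume_preserving_symm_measurableEquiv_toLp (Fin 3)
  have h2 := volume_preserving_piFinSuccAbove (fun _ : Fin 3 => ℝ) 0
  have h3 := (MeasurePreserving.id (volume : Measure ℝ)).prod (volume_preserving_finTwoArrow ℝ)
  exact h3.comp (h2.comp h1)

lemma vol_set {S : Set (ℝ × ℝ × ℝ)} (hS : MeasurableSet S) :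
    volume S = ∫⁻ x : ℝ, ∫⁻ y : ℝ, volume {z : ℝ | (x, y, z) ∈ S} := by
  rw [Measure.volume_eq_prod, Measure.prod_apply hS]
  congr 1; ext x
  rw [Measure.volume_eq_prod, Measure.prod_apply (measurable_prodMk_left hS)]
  rfl

/-- integral of a nonnegative function over an interval, via an antiderivative -/
lemma lint_of_deriv {a b : ℝ} (hab : a ≤ b) {F g : ℝ → ℝ} (hF : ∀ x, HasDerivAt F (g x) x)
    (hg : Continuous g) (hpos : ∀ x ∈ Set.Ioo a b, 0 ≤ g x) :
    ∫⁻ x in Set.Ioo a b, ENNReal.ofReal (g x) = ENNReal.ofReal (F b - F a) := by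
  have hi : IntervalIntegrable g volume a b := hg.intervalIntegrable _ _
  rw [← intervalIntegral.integral_eq_sub_of_hasDerivAt (fun x _ => hF x) hi,
    intervalIntegral.integral_of_le hab, integral_Ioc_eq_integral_Ioo,
    ofReal_integral_eq_lintegral_ofReal]
  · rw [intervalIntegrable_iff_integrableOn_Ioo_of_le hab] at hi
    exact hi
  · exact (ae_restrict_iff' measurableSet_Ioo).2 (Filter.Eventually.of_forall hpos)

lemma vol_closedO : volume closedO ≤ ENNReal.ofReal (√2 / 36) := by
  have s2 : √(2:ℝ) * √2 = 2 := Real.mul_self_sqrt (by norm_num)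
  have s3 : √(3:ℝ) * √3 = 3 := Real.mul_self_sqrt (by norm_num)
  have n2 : 0 < √(2:ℝ) := by positivity
  have n3 : 0 < √(3:ℝ) := by positivity
  let S : Set (ℝ × ℝ × ℝ) := {q | 0 ≤ q.2.2 ∧ √2 * q.2.2 ≤ q.2.1 ∧ √3 * q.2.1 ≤ q.1 ∧ q.1 ≤ 1}
  have hS : MeasurableSet S := by
    simp only [S]; measurability
  have e : closedO = (fun c : EuclideanSpace ℝ (Fin 3) => (c 0, c 1, c 2)) ⁻¹' S := rfl
  rw [e, coord_mp.measure_preimage hS.nullMeasurableSet, vol_set hS]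
  have hz : ∀ x y : ℝ, volume {z : ℝ | (x, y, z) ∈ S} ≤
      (Set.Icc (0:ℝ) 1).indicator (fun x => (Set.Icc 0 (x / √3)).indicator
        (fun y => ENNReal.ofReal (y / √2)) y) x := by
    intro x y
    by_cases hx : x ∈ Set.Icc (0:ℝ) 1
    · rw [Set.indicator_of_mem hx]
      by_cases hy : y ∈ Set.Icc 0 (x / √3)
      · rw [Set.indicator_of_mem hy]
        calc _ ≤ volume (Set.Icc 0 (y / √2)) := by
              apply measure_mono
              rintro z ⟨a1, a2, a3, a4⟩
              refine ⟨a1, ?_⟩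
              rw [le_div_iff₀ n2, mul_comm]; exact a2
          _ = _ := by rw [Real.volume_Icc, sub_zero]
      · rw [Set.indicator_of_notMem hy]
        have : {z : ℝ | (x, y, z) ∈ S} = ∅ := by
          ext z
          simp only [Set.mem_empty_iff_false, iff_false]
          rintro ⟨a1, a2, a3, a4⟩
          simp only at a1 a2 a3 a4
          exact hy ⟨by nlinarith, by rw [le_div_iff₀ n3, mul_comm]; exact a3⟩
        rw [this]; simp
    · rw [Set.indicator_of_notMem hx]
      have : {z : ℝ | (x, y, z) ∈ S} = ∅ := by
        ext z
        simp only [Set.mem_empty_iff_false, iff_false]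
        rintro ⟨a1, a2, a3, a4⟩
        simp only at a1 a2 a3 a4
        have : 0 ≤ y := by nlinarith
        exact hx ⟨by nlinarith, a4⟩
      rw [this]; simp
  calc _ ≤ ∫⁻ x : ℝ, ∫⁻ y : ℝ, (Set.Icc (0:ℝ) 1).indicator (fun x => (Set.Icc 0 (x / √3)).indicator
        (fun y => ENNReal.ofReal (y / √2)) y) x :=
        lintegral_mono fun x => lintegral_mono fun y => hz x y
    _ = ∫⁻ x : ℝ, (Set.Icc (0:ℝ) 1).indicator (fun x => ENNReal.ofReal (√2 / 12 * x^2)) x := by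
        congr 1; ext x
        by_cases hx : x ∈ Set.Icc (0:ℝ) 1
        · simp only [Set.indicator_of_mem hx]
          rw [lintegral_indicator measurableSet_Icc, ← restrict_Ioo_eq_restrict_Icc,
            lint_of_deriv (F := fun y => y^2/2/√2) (by have := hx.1; positivity)]
          · congr 1
            rw [div_pow, Real.sq_sqrt (by norm_num)]
            field_simp
            rw [Real.sq_sqrt (by norm_num)]; ring
          · intro y
            have := (((hasDerivAt_pow 2 y).div_const 2).div_const (√2))
            exact this.congr_deriv (by norm_num)
          · fun_prop
          · intro y hy; have := hy.1; positivity
        · simp only [Set.indicator_of_notMem hx]; simp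
    _ = _ := by
        rw [lintegral_indicator measurableSet_Icc, ← restrict_Ioo_eq_restrict_Icc,
            lint_of_deriv (F := fun y => √2 / 36 * y^3) (by norm_num)]
        · norm_num
        · intro y
          have := ((hasDerivAt_pow 3 y).const_mul (√2/36))
          exact this.congr_deriv (by norm_num; ring)
        · fun_prop
        · intro y hy; positivity

lemma deriv_F (l s : ℝ) : HasDerivAt
    (fun s : ℝ => (l^2/2-1/6) * Real.arctan s - l^3/3 * Real.arctan (√3 * s / √(4+s^2)))
    ((l^2 - 1/3 - 2/3*l^2*(l*√3/√(4+s^2)))/(2*(1+s^2))) s := by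
  have s3 : √(3:ℝ)^2 = 3 := Real.sq_sqrt (by norm_num)
  have hp : 0 < 4 + s^2 := by positivity
  have hr : 0 < √(4+s^2) := Real.sqrt_pos.2 hp
  have hr2 : √(4+s^2)^2 = 4+s^2 := Real.sq_sqrt hp.le
  have d1 : HasDerivAt (fun s : ℝ => 4 + s^2) (2*s) s := by
    have := (hasDerivAt_pow 2 s).const_add 4
    exact this.congr_deriv (by norm_num)
  have d2 := d1.sqrt hp.ne'
  have d3 := (((hasDerivAt_id s).const_mul √3).div d2 hr.ne').arctan
  have d4 := ((Real.hasDerivAt_arctan s).const_mul (l^2/2-1/6)).sub (d3.const_mul (l^3/3))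
  refine d4.congr_deriv ?_
  simp only [id, Pi.div_apply]
  generalize √(4+s^2) = r at hr hr2
  have e1 : 1 + (√3 * s / r)^2 = 4 * (1 + s^2) / r^2 := by
    rw [div_pow, mul_pow, s3]
    field_simp
    rw [hr2]; ring
  have e2 : (√3 * 1 * r - √3 * s * (2 * s / (2 * r))) / r ^ 2 = 4 * √3 / r^3 := by
    field_simp
    rw [hr2]; ring
  rw [e1, e2]
  field_simp
  ring

lemma vol_openO (l : ℝ) (h1 : 1 ≤ l) (h2 : 3 * l^2 < 4) :
    ENNReal.ofReal (Real.arctan (1 / √2) * (l^2/2 - 1/6) - Real.pi * l^3/18) ≤ volume (openO l) := by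
  have s2 : √(2:ℝ) * √2 = 2 := Real.mul_self_sqrt (by norm_num)
  have s3 : √(3:ℝ) * √3 = 3 := Real.mul_self_sqrt (by norm_num)
  have n2 : 0 < √(2:ℝ) := by positivity
  have n3 : 0 < √(3:ℝ) := by positivity
  let S : Set (ℝ × ℝ × ℝ) := {q | 0 < q.2.2 ∧ √2 * q.2.2 < q.2.1 ∧ √3 * q.2.1 < q.1 ∧ q.1 < 1 ∧
    q.1^2 + q.2.1^2 + q.2.2^2 ≤ l^2}
  have hS : MeasurableSet S := by
    simp only [S]; measurability
  have e : openO l = (fun c : EuclideanSpace ℝ (Fin 3) => (c 0, c 1, c 2)) ⁻¹' S := rfl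
  rw [e, coord_mp.measure_preimage hS.nullMeasurableSet, vol_set hS]
  let T : Set (ℝ × ℝ × ℝ) := {q | 0 < q.2.1 ∧ 0 < q.2.2 ∧ √2 * q.2.2 < 1 ∧ √3 * q.2.1 < q.1 ∧ q.1 < 1 ∧
    q.1^2 + q.2.1^2 * (1 + q.2.2^2) ≤ l^2}
  have hT : MeasurableSet T := by
    simp only [T]; measurability
  let G : ℝ × ℝ × ℝ → ENNReal := T.indicator (fun q => ENNReal.ofReal q.2.1)
  have hG : Measurable G := by
    refine Measurable.indicator ?_ hT
    fun_prop
  have hz : ∀ x y : ℝ, ∫⁻ s, G (x, y, s) ≤ volume {z : ℝ | (x, y, z) ∈ S} := by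
    intro x y
    rcases le_or_gt y 0 with hy | hy
    · have : ∀ s, G (x, y, s) = 0 := by
        intro s
        apply Set.indicator_of_notMem
        rintro ⟨a, -⟩
        exact absurd a (not_lt.2 hy)
      simp [this]
    · have e1 := Real.volume_preimage_mul_left hy.ne' {z : ℝ | (x, y, z) ∈ S}
      have e2 : ∀ s, G (x, y, s) = ((fun x => y * x) ⁻¹' {z : ℝ | (x, y, z) ∈ S}).indicator
          (fun _ => ENNReal.ofReal y) s := by
        intro s
        have : (x, y, s) ∈ T ↔ s ∈ ((fun x => y * x) ⁻¹' {z : ℝ | (x, y, z) ∈ S}) := by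
          simp only [T, S, Set.mem_ofPred_eq, Set.mem_preimage]
          have i1 : 0 < y * s ↔ 0 < s := mul_pos_iff_of_pos_left hy
          have i2 : √2 * (y * s) < y ↔ √2 * s < 1 := by
            rw [show √2 * (y * s) = y * (√2 * s) by ring]
            exact mul_lt_iff_lt_one_right hy
          have i3 : x^2 + y^2 + (y*s)^2 = x^2 + y^2 * (1 + s^2) := by ring
          rw [i1, i2, i3]
          tauto
        by_cases h : (x, y, s) ∈ T
        · rw [Set.indicator_of_mem (this.1 h)]
          exact Set.indicator_of_mem h _
        · rw [Set.indicator_of_notMem (fun h' => h (this.2 h'))]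
          exact Set.indicator_of_notMem h _
      have hm : MeasurableSet {z : ℝ | (x, y, z) ∈ S} :=
        measurable_prodMk_left (measurable_prodMk_left hS)
      simp only [e2]
      rw [lintegral_indicator_const (hm.preimage (measurable_const_mul y)), e1, ← mul_assoc,
        ← ENNReal.ofReal_mul hy.le, abs_of_pos (inv_pos.2 hy), mul_inv_cancel₀ hy.ne']
      simp
  refine le_trans ?_ (lintegral_mono fun x => lintegral_mono fun y => hz x y)
  have sw : ∫⁻ x, ∫⁻ y, ∫⁻ s, G (x, y, s) = ∫⁻ s, ∫⁻ x, ∫⁻ y, G (x, y, s) := by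
    have : ∀ x, ∫⁻ y, ∫⁻ s, G (x, y, s) = ∫⁻ s, ∫⁻ y, G (x, y, s) := by
      intro x
      refine lintegral_lintegral_swap (f := fun y s => G (x, y, s)) ?_
      exact (hG.comp measurable_prodMk_left).aemeasurable
    simp only [this]
    refine lintegral_lintegral_swap (f := fun x s => ∫⁻ y, G (x, y, s)) ?_
    apply Measurable.aemeasurable
    have hc : Measurable (fun q : (ℝ × ℝ) × ℝ => G (q.1.1, q.2, q.1.2)) :=
      hG.comp (by fun_prop)
    exact hc.lintegral_prod_right'
  rw [sw]
  have hy : ∀ s x m : ℝ, s ∈ Set.Ioo 0 (1/√2) → x < 1 → 0 ≤ m → √3 * m ≤ x →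
      x^2 + m^2 * (1+s^2) ≤ l^2 → ENNReal.ofReal (m^2/2) ≤ ∫⁻ y, G (x, y, s) := by
    intro s x m hs hx hm hmx hml
    have e1 := lint_of_deriv (F := fun y => y^2/2) (g := fun y => y) hm
      (fun y => ((hasDerivAt_pow 2 y).div_const 2).congr_deriv (by norm_num)) (by fun_prop)
      (fun y hy => hy.1.le)
    have e2 : m^2/2 = m^2/2 - 0^2/2 := by ring
    rw [e2, ← e1, ← lintegral_indicator measurableSet_Ioo]
    apply lintegral_mono
    intro y
    apply Set.indicator_le
    intro y hy
    have : (x, y, s) ∈ T := by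
      refine ⟨hy.1, hs.1, ?_, ?_, hx, ?_⟩
      · have := hs.2
        rw [lt_div_iff₀ n2] at this
        simp only; linarith
      · have := mul_lt_mul_of_pos_left hy.2 n3
        simp only; linarith
      · have : y^2 ≤ m^2 := pow_le_pow_left₀ hy.1.le hy.2.le 2
        have := mul_le_mul_of_nonneg_right this (by positivity : 0 ≤ 1 + s^2)
        simp only; linarith
    exact (Set.indicator_of_mem this (fun q : ℝ × ℝ × ℝ => ENNReal.ofReal q.2.1)).ge
  have hX : ∀ s, (l*√3/√(4+s^2))^2 * (4+s^2) = 3*l^2 ∧ 0 < l*√3/√(4+s^2) ∧ l*√3/√(4+s^2) < 1 := by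
    intro s
    have hp : 0 < 4 + s^2 := by positivity
    have hr : 0 < √(4+s^2) := Real.sqrt_pos.2 hp
    have hr2 : √(4+s^2)^2 = 4+s^2 := Real.sq_sqrt hp.le
    have a : (l*√3/√(4+s^2))^2 * (4+s^2) = 3*l^2 := by
      rw [div_pow, hr2, mul_pow, Real.sq_sqrt (by norm_num)]
      field_simp
    refine ⟨a, by positivity, ?_⟩
    by_contra hcon
    push Not at hcon
    have : 1 ≤ (l*√3/√(4+s^2))^2 := one_le_pow₀ hcon
    nlinarith
  have hs : ∀ s ∈ Set.Ioo 0 (1/√2),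
      ENNReal.ofReal ((l^2 - 1/3 - 2/3*l^2*(l*√3/√(4+s^2)))/(2*(1+s^2))) ≤ ∫⁻ x, ∫⁻ y, G (x, y, s) := by
    intro s hs
    obtain ⟨x1, x2, x3⟩ := hX s
    generalize l*√3/√(4+s^2) = X at x1 x2 x3
    have f1 := lint_of_deriv (F := fun y => y^3/18) (g := fun y => y^2/6) x2.le
      (fun y => ((hasDerivAt_pow 3 y).div_const 18).congr_deriv (by norm_num; ring)) (by fun_prop)
      (fun y hy => by positivity)
    have hpos : ∀ y ∈ Set.Ioo X 1, 0 ≤ (l^2 - y^2)/(1+s^2) := by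
      intro y hy
      have : y^2 ≤ 1 := pow_le_one₀ (x2.trans hy.1).le hy.2.le
      have : 0 ≤ l^2 - y^2 := by nlinarith
      positivity
    have f2 := lint_of_deriv (F := fun y => (l^2*y - y^3/3)/(1+s^2)/2)
      (g := fun y => (l^2 - y^2)/(1+s^2)/2) x3.le
      (fun y => (((((hasDerivAt_id y).const_mul (l^2)).sub
        ((hasDerivAt_pow 3 y).div_const 3)).div_const (1+s^2)).div_const 2).congr_deriv
          (by norm_num)) (by fun_prop)
      (fun y hy => by have := hpos y hy; positivity)
    have hX3 : X^3 ≤ 1 := pow_le_one₀ x2.le x3.le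
    have hnn : 0 ≤ (l^2*1 - 1^3/3)/(1+s^2)/2 - (l^2*X - X^3/3)/(1+s^2)/2 := by
      have : 0 ≤ (l^2*1 - 1^3/3) - (l^2*X - X^3/3) := by
        have hl1 : 0 ≤ (l^2 - 1) * (1 - X) := mul_nonneg (by nlinarith) (by linarith)
        have hl2 : 0 ≤ (1 - X)^2 * (2 + X) := by positivity
        nlinarith
      have e : (l^2*1 - 1^3/3)/(1+s^2)/2 - (l^2*X - X^3/3)/(1+s^2)/2 =
        ((l^2*1 - 1^3/3) - (l^2*X - X^3/3))/(1+s^2)/2 := by ring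
      rw [e]; positivity
    have val : (l^2 - 1/3 - 2/3*l^2*X)/(2*(1+s^2)) = (X^3/18 - 0^3/18) +
        ((l^2*1 - 1^3/3)/(1+s^2)/2 - (l^2*X - X^3/3)/(1+s^2)/2) := by
      have hne : (1 + s^2) ≠ 0 := by positivity
      field_simp
      linear_combination (-6 * X) * x1
    have g1 : ∫⁻ x in Set.Ioo 0 X, ENNReal.ofReal (x^2/6) ≤ ∫⁻ x in Set.Ioo 0 X, ∫⁻ y, G (x, y, s) := by
      refine setLIntegral_mono' measurableSet_Ioo fun x hx => ?_
      have := hy s x (x/√3) hs (hx.2.trans x3) (by have := hx.1; positivity)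
        (by rw [mul_div_cancel₀ _ n3.ne']) (by
          rw [div_pow, Real.sq_sqrt (by norm_num)]
          have : x^2 ≤ X^2 := pow_le_pow_left₀ hx.1.le hx.2.le 2
          nlinarith [mul_le_mul_of_nonneg_right this (by positivity : 0 ≤ 4 + s^2)])
      rw [div_pow, Real.sq_sqrt (by norm_num)] at this
      convert this using 2
      ring
    have g2 : ∫⁻ x in Set.Ioo X 1, ENNReal.ofReal ((l^2 - x^2)/(1+s^2)/2) ≤
        ∫⁻ x in Set.Ioo X 1, ∫⁻ y, G (x, y, s) := by
      refine setLIntegral_mono' measurableSet_Ioo fun x hx => ?_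
      have hp := hpos x hx
      have hq := Real.sq_sqrt hp
      have hx0 : 0 < x := x2.trans hx.1
      have hne : (1 + s^2) ≠ 0 := by positivity
      have := hy s x (√((l^2 - x^2)/(1+s^2))) hs hx.2 (Real.sqrt_nonneg _)
        (by
          refine le_of_sq_le_sq ?_ hx0.le
          rw [mul_pow, hq, Real.sq_sqrt (by norm_num), ← mul_div_assoc, div_le_iff₀ (by positivity)]
          have : X^2 ≤ x^2 := pow_le_pow_left₀ x2.le hx.1.le 2
          nlinarith [mul_le_mul_of_nonneg_right this (by positivity : 0 ≤ 4 + s^2)]) (by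
          rw [hq, div_mul_cancel₀ _ hne]; linarith)
      rw [hq] at this
      exact this
    rw [val, ENNReal.ofReal_add (by norm_num; positivity) hnn, ← f1, ← f2]
    refine (add_le_add g1 g2).trans ?_
    rw [← lintegral_union measurableSet_Ioo]
    · exact setLIntegral_le_lintegral _ _
    · rw [Set.disjoint_left]
      intro x ha hb
      exact absurd ha.2 (not_lt.2 hb.1.le)
  have fin := lint_of_deriv (a := 0) (b := 1/√2) (by positivity) (deriv_F l)
    (by
      refine Continuous.div ?_ (by fun_prop) (fun s => by positivity)
      refine Continuous.sub continuous_const (Continuous.mul continuous_const ?_)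
      refine Continuous.div continuous_const (by fun_prop) (fun s => ?_)
      exact (Real.sqrt_pos.2 (by positivity)).ne')
    (by
      intro s hs
      obtain ⟨x1, x2, x3⟩ := hX s
      apply div_nonneg _ (by positivity)
      nlinarith)
  have val : Real.arctan (1 / √2) * (l^2/2 - 1/6) - Real.pi * l^3/18 =
    ((l^2/2-1/6) * Real.arctan (1/√2) - l^3/3 * Real.arctan (√3 * (1/√2) / √(4+(1/√2)^2))) -
    ((l^2/2-1/6) * Real.arctan 0 - l^3/3 * Real.arctan (√3 * 0 / √(4+0^2))) := by
    have a : √3 * (1/√2) / √(4+(1/√2)^2) = (√3)⁻¹ := by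
      have : (4:ℝ)+(1/√2)^2 = (3/√2)^2 := by
        rw [div_pow, div_pow, Real.sq_sqrt (by norm_num)]; norm_num
      rw [this, Real.sqrt_sq (by positivity)]
      field_simp
      linarith
    rw [a, Real.arctan_inv_sqrt_three]
    simp
    ring
  rw [val, ← fin, ← lintegral_indicator measurableSet_Ioo]
  apply lintegral_mono
  intro s
  apply Set.indicator_le
  exact fun s h => hs s h

/-- For `0 ≤ λ < 2/√3 - 1`, `ℓ = 1 + λ`, `φ₀ = arctan(1/√2)`, and a regular `3`-simplex
`T³ = conv{t 1, …, t 4}` of edge length `2` in `E³`, setting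
`σ̄₃(λ) = vol₃(T³ ∩ ⋃ (t i + ℓB³)) / vol₃(T³)`, one has
`((20√6·φ₀ - 4√6·π - 10π)·ℓ³ + 18π·ℓ² - 6π) / (3π - 15φ₀ + 5√2) < σ̄₃(λ)`. -/
theorem improved_bound_lt_simplex_bound_dim_three (lam : ℝ) (hlam0 : 0 ≤ lam)
    (hlam1 : lam < 2 / Real.sqrt 3 - 1)
    (t : Fin 4 → EuclideanSpace ℝ (Fin 3))
    (ht : ∀ i j : Fin 4, i ≠ j → ‖t i - t j‖ = 2) :
    ((20 * Real.sqrt 6 * Real.arctan (1 / Real.sqrt 2) - 4 * Real.sqrt 6 * Real.pi -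
        10 * Real.pi) * (1 + lam) ^ 3 + 18 * Real.pi * (1 + lam) ^ 2 - 6 * Real.pi) /
      (3 * Real.pi - 15 * Real.arctan (1 / Real.sqrt 2) + 5 * Real.sqrt 2) <
    (volume (convexHull ℝ (Set.range t) ∩
        ⋃ i : Fin 4, closedBall (t i) (1 + lam))).toReal /
      (volume (convexHull ℝ (Set.range t))).toReal := by
  have n3 : 0 < √(3:ℝ) := by positivity
  set l := 1 + lam with hl
  have h1 : 1 ≤ l := by linarith
  have h2 : l < 2 / √3 := by linarith
  have h3 : 3 * l^2 < 4 := by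
    have a : l^2 < (2/√3)^2 := pow_lt_pow_left₀ h2 (by linarith) (by norm_num)
    rw [div_pow, Real.sq_sqrt (by norm_num)] at a
    linarith
  have hn := num l h1 h2
  have hlow := geo_lower l (by linarith) t ht
  have hup := geo_upper t ht
  have hv := vol_openO l h1 h3
  have hc := vol_closedO
  refine hn.trans_le ?_
  set V := Real.arctan (1 / √2) * (l^2/2 - 1/6) - Real.pi * l^3/18 with hV
  have hVpos : 0 < V := by
    obtain ⟨p1, p2⟩ := phi_bounds
    have q2 := Real.pi_lt_d6
    have hl3 : l < 1.1548 := by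
      have h3a : 1.732 < √(3:ℝ) := Real.lt_sqrt_of_sq_lt (by norm_num)
      refine h2.trans ?_
      rw [div_lt_iff₀ (by positivity)]; linarith
    have e1 : 0.615 * (l^2/2-1/6) ≤ Real.arctan (1 / √2) * (l^2/2 - 1/6) :=
      mul_le_mul_of_nonneg_right p1.le (by nlinarith)
    have e2 : Real.pi * l^3 ≤ 3.141593 * l^3 := mul_le_mul_of_nonneg_right q2.le (by positivity)
    have e3 : l^3 ≤ 1.1548 * l^2 := by nlinarith [sq_nonneg l]
    nlinarith
  set A := volume (convexHull ℝ (Set.range t) ∩ ⋃ i : Fin 4, closedBall (t i) l)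
  set B := volume (convexHull ℝ (Set.range t))
  have hAB : A ≤ B := measure_mono Set.inter_subset_left
  have hB : B ≤ ENNReal.ofReal (2 * √2 / 3) := by
    calc B ≤ 24 * ENNReal.ofReal (√2/36) := hup.trans (by gcongr)
      _ = ENNReal.ofReal (2 * √2 / 3) := by
        rw [show (24 : ENNReal) = ENNReal.ofReal 24 by simp, ← ENNReal.ofReal_mul (by norm_num)]
        congr 1; ring
  have hA : ENNReal.ofReal (24 * V) ≤ A := by
    calc ENNReal.ofReal (24 * V) = 24 * ENNReal.ofReal V := by
          rw [ENNReal.ofReal_mul (by norm_num)]; simp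
      _ ≤ 24 * volume (openO l) := by gcongr
      _ ≤ A := hlow
  have hBtop : B ≠ ⊤ := ne_top_of_le_ne_top ENNReal.ofReal_ne_top hB
  have hAtop : A ≠ ⊤ := ne_top_of_le_ne_top hBtop hAB
  have rA : 24 * V ≤ A.toReal := (ENNReal.ofReal_le_iff_le_toReal hAtop).1 hA
  have rB : B.toReal ≤ 2 * √2 / 3 := ENNReal.toReal_le_of_le_ofReal (by positivity) hB
  have rAB : A.toReal ≤ B.toReal := ENNReal.toReal_mono hBtop hAB
  have hBpos : 0 < B.toReal := by linarith
  exact div_le_div₀ (by linarith) rA hBpos rB
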